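/- (Linear Frobenius theorem.) Let F^k_{ji} : ℝⁿ → ℝ (with j, k ∈ Fin p and i ∈ Fin n) be smooth functions satisfying the integrability condition ∂_k F^a_{ji} − ∂_i F^a_{jk} + Σ_r (F^a_{rk} F^r_{ji} − F^a_{ri} F^r_{jk}) = 0 at every point of ℝⁿ, for all a, j ∈ Fin p and i, k ∈ Fin n. Then for every x₀ ∈ ℝⁿ and every y₀ ∈ ℝᵖ there exists exactly one smooth function y : ℝⁿ → ℝᵖ such that ∂y_j/∂x^i (x) = Σ_k F^k_{ji}(x) y_k(x) for all x, i, j, and y(x₀) = y₀. -/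

import Mathlib

/-- The partial derivative of `f : ℝⁿ → ℝ` in the `i`-th coordinate direction. -/
noncomputable def pd {n : ℕ} (i : Fin n) (f : (Fin n → ℝ) → ℝ) (x : Fin n → ℝ) : ℝ :=
  fderiv ℝ f x (Pi.single i 1)

section helpers

set_option maxSynthPendingDepth 3

open Set Metric Topology

/-- right derivative from derivative within `[0,1]`. -/
lemma lf_right {V : Type*} [NormedAddCommGroup V] [NormedSpace ℝ V] {α : ℝ → V} {v : V} {t : ℝ}
    (h : HasDerivWithinAt α v (Icc 0 1) t) (ht : t ∈ Ico (0:ℝ) 1) :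
    HasDerivWithinAt α v (Ici t) t :=
  h.mono_of_mem_nhdsWithin (Icc_mem_nhdsGE_of_mem ht)

lemma lf_ode {p : ℕ} (B : ℝ → (Fin p → ℝ) →L[ℝ] (Fin p → ℝ)) (hB : Continuous B)
    (y₀ : Fin p → ℝ) :
    ∃ α : ℝ → (Fin p → ℝ), α 0 = y₀ ∧
      ∀ t ∈ Icc (0:ℝ) 1, HasDerivWithinAt α (B t (α t)) (Icc 0 1) t := by
  obtain ⟨M₀, hM₀⟩ := isCompact_Icc.exists_bound_of_continuousOn (s := Icc (0:ℝ) 1) hB.continuousOn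
  obtain ⟨M, hMeq⟩ : ∃ M : NNReal, (M : ℝ) = max M₀ 0 := ⟨⟨_, le_max_right _ _⟩, rfl⟩
  have hM : ∀ t ∈ Icc (0:ℝ) 1, ‖B t‖ ≤ M := fun t ht => by
    rw [hMeq]; exact (hM₀ t ht).trans (le_max_left _ _)
  obtain ⟨R, hR⟩ : ∃ R : NNReal, (R : ℝ) = ‖y₀‖ * Real.exp M := ⟨⟨_, by positivity⟩, rfl⟩
  set φ : (Fin p → ℝ) → (Fin p → ℝ) := fun y i => max (-(R:ℝ)) (min R (y i)) with hφ
  have hφb : ∀ y, ‖φ y‖ ≤ R := by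
    intro y
    rw [pi_norm_le_iff_of_nonneg R.coe_nonneg]
    intro i
    rw [Real.norm_eq_abs, abs_le]
    exact ⟨le_max_left _ _, max_le (by have := R.2; simp) (min_le_left _ _)⟩
  have hφ1 : ∀ y, ‖φ y‖ ≤ ‖y‖ := by
    intro y
    rw [pi_norm_le_iff_of_nonneg (norm_nonneg _)]
    intro i
    refine le_trans ?_ (norm_le_pi_norm y i)
    have hR0 : (0:ℝ) ≤ R := R.2
    simp only [hφ, Real.norm_eq_abs]
    rcases le_total (-(R:ℝ)) (min R (y i)) with h | h
    · rw [max_eq_right h]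
      rcases le_total (R:ℝ) (y i) with h' | h'
      · rw [min_eq_left h']; rw [abs_of_nonneg hR0]; exact h'.trans (le_abs_self _)
      · rw [min_eq_right h']
    · rw [max_eq_left h, abs_neg, abs_of_nonneg hR0]
      rcases le_total (R:ℝ) (y i) with h' | h'
      · exact h'.trans (le_abs_self _)
      · rw [min_eq_right h'] at h
        have := neg_le_abs (y i); linarith
  have hφ2 : ∀ y z, ‖φ y - φ z‖ ≤ ‖y - z‖ := by
    intro y z
    rw [pi_norm_le_iff_of_nonneg (norm_nonneg _)]
    intro i
    refine le_trans ?_ (norm_le_pi_norm (y - z) i)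
    simp only [hφ, Real.norm_eq_abs, Pi.sub_apply]
    refine (abs_max_sub_max_le_max _ _ _ _).trans ?_
    simp only [sub_self, abs_zero]
    refine max_le (abs_nonneg _) ((abs_min_sub_min_le_max _ _ _ _).trans ?_)
    simp
  have hφ3 : ∀ y, ‖y‖ ≤ R → φ y = y := by
    intro y hy
    funext i
    have := (norm_le_pi_norm y i).trans hy
    rw [Real.norm_eq_abs, abs_le] at this
    simp only [hφ]
    rw [min_eq_right this.2, max_eq_right this.1]
  have hPL : IsPicardLindelof (fun t y => B t (φ y)) (tmin := 0) (tmax := 1)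
      ⟨0, by simp⟩ y₀ (M * R) 0 (M * R) M := by
    refine ⟨?_, ?_, ?_, ?_⟩
    · intro t ht
      refine LipschitzOnWith.of_dist_le_mul fun y _ z _ => ?_
      rw [dist_eq_norm, dist_eq_norm, ← map_sub]
      refine (ContinuousLinearMap.le_opNorm _ _).trans ?_
      exact mul_le_mul (hM t ht) (hφ2 y z) (norm_nonneg _) M.2
    · intro y _
      exact (hB.clm_apply continuous_const).continuousOn
    · intro t ht y _
      refine (ContinuousLinearMap.le_opNorm _ _).trans ?_
      push_cast
      exact mul_le_mul (hM t ht) (hφb y) (norm_nonneg _) M.2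
    · simp
  obtain ⟨α, h0, hα⟩ := hPL.exists_eq_forall_mem_Icc_hasDerivWithinAt₀
  have h0 : α 0 = y₀ := h0
  have hbd := norm_le_gronwallBound_of_norm_deriv_right_le (f := α)
    (f' := fun t => B t (φ (α t))) (δ := ‖y₀‖) (K := M) (ε := 0) (a := 0) (b := 1)
    (fun t ht => (hα t ht).continuousWithinAt)
    (fun t ht => lf_right (hα t (Ico_subset_Icc_self ht)) ht) (by rw [h0]) (by
      intro t ht
      rw [add_zero]
      refine (ContinuousLinearMap.le_opNorm _ _).trans ?_
      exact mul_le_mul (hM t (Ico_subset_Icc_self ht)) (hφ1 _) (norm_nonneg _) M.2)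
  refine ⟨α, h0, fun t ht => ?_⟩
  have h1 := hbd t ht
  rw [gronwallBound_ε0] at h1
  have h2 : ‖α t‖ ≤ R := by
    refine h1.trans ?_
    rw [hR]
    gcongr
    have : (0:ℝ) ≤ M := M.2
    have := ht.2
    nlinarith
  have := hα t ht
  rwa [hφ3 _ h2] at this

section core
variable {E V : Type*} [NormedAddCommGroup E] [NormedSpace ℝ E]
  [NormedAddCommGroup V] [NormedSpace ℝ V]

lemma lf_unif {W : Type*} [NormedAddCommGroup W] [NormedSpace ℝ W]
    (A : E → W) (hA : ContDiff ℝ 1 A) (x₀ u : E) {ε : ℝ} (hε : 0 < ε) :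
    ∃ δ > 0, ∀ h : E, ‖h‖ < δ → ∀ t ∈ Icc (0:ℝ) 1,
      ‖A (x₀ + t • (u + h)) - A (x₀ + t • u) - t • fderiv ℝ A (x₀ + t • u) h‖ ≤ ε * ‖h‖ := by
  have hc : IsCompact ((fun t : ℝ => x₀ + t • u) '' Icc 0 1) :=
    isCompact_Icc.image (by fun_prop)
  have hd : Continuous (fderiv ℝ A) := hA.continuous_fderiv (by simp)
  have hu := hc.uniformContinuousAt_of_continuousAt (fderiv ℝ A)
    (fun a _ => hd.continuousAt) (dist_mem_uniformity hε)
  obtain ⟨δ, hδ, H⟩ := Metric.mem_uniformity_dist.1 hu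
  refine ⟨δ, hδ, fun h hh t ht => ?_⟩
  have hth : ‖t • h‖ ≤ ‖h‖ := by
    rw [norm_smul, Real.norm_eq_abs, abs_of_nonneg ht.1]
    exact mul_le_of_le_one_left (norm_nonneg _) ht.2
  have key := (convex_ball (x₀ + t • u) δ).norm_image_sub_le_of_norm_fderiv_le' (𝕜 := ℝ) (f := A)
    (φ := fderiv ℝ A (x₀ + t • u)) (C := ε) (x := x₀ + t • u) (y := x₀ + t • (u + h))
    (fun x _ => hA.differentiable (by simp) x)
    (fun x hx => by
      have := H (a := x₀ + t • u) (b := x) (by rw [dist_comm]; exact hx) ⟨t, ht, rfl⟩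
      simp only [mem_ofPred_eq] at this
      rw [← dist_eq_norm, dist_comm]
      exact this.le)
    (mem_ball_self hδ) (by
      rw [mem_ball, dist_eq_norm, smul_add, add_sub_add_left_eq_sub, add_sub_cancel_left]
      exact hth.trans_lt hh)
  have e : x₀ + t • (u + h) - (x₀ + t • u) = t • h := by module
  rw [e, map_smul] at key
  exact key.trans (by gcongr)

set_option maxHeartbeats 2000000 in
lemma lf_core (A : E → E →L[ℝ] V →L[ℝ] V) (hA : ContDiff ℝ 1 A)
    (flat : ∀ x v w y, fderiv ℝ A x v w y + A x w (A x v y)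
      = fderiv ℝ A x w v y + A x v (A x w y))
    (x₀ : E) (y₀ : V) (Y : E → ℝ → V) (hY0 : ∀ u, Y u 0 = y₀)
    (hY : ∀ u, ∀ t ∈ Icc (0:ℝ) 1,
      HasDerivWithinAt (Y u) (A (x₀ + t • u) u (Y u t)) (Icc 0 1) t) (x : E) :
    HasFDerivAt (fun x => Y (x - x₀) 1) ((A x).flip (Y (x - x₀) 1)) x := by
  obtain ⟨u, rfl⟩ : ∃ u, x = x₀ + u := ⟨x - x₀, by abel⟩
  rw [hasFDerivAt_iff_isLittleO_nhds_zero]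
  have hd : Continuous (fderiv ℝ A) := hA.continuous_fderiv (by simp)
  have hAc := hA.continuous
  have hcA : Continuous (fun t : ℝ => A (x₀ + t • u)) := hAc.comp (by fun_prop)
  have hcD : Continuous (fun t : ℝ => fderiv ℝ A (x₀ + t • u)) := hd.comp (by fun_prop)
  obtain ⟨M₁, hM₁⟩ := isCompact_Icc.exists_bound_of_continuousOn (s := Icc (0:ℝ) 1)
    (f := fun t : ℝ => A (x₀ + t • u)) hcA.continuousOn
  obtain ⟨M₂, hM₂⟩ := isCompact_Icc.exists_bound_of_continuousOn (s := Icc (0:ℝ) 1)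
    (f := fun t : ℝ => fderiv ℝ A (x₀ + t • u)) hcD.continuousOn
  obtain ⟨M₃, hM₃⟩ := isCompact_Icc.exists_bound_of_continuousOn (s := Icc (0:ℝ) 1)
    (fun t ht => (hY u t ht).continuousWithinAt)
  obtain ⟨M, hM0, hMA, hMD, hMY, hMu⟩ : ∃ M : ℝ, 0 ≤ M ∧
      (∀ t ∈ Icc (0:ℝ) 1, ‖A (x₀ + t • u)‖ ≤ M) ∧
      (∀ t ∈ Icc (0:ℝ) 1, ‖fderiv ℝ A (x₀ + t • u)‖ ≤ M) ∧
      (∀ t ∈ Icc (0:ℝ) 1, ‖Y u t‖ ≤ M) ∧ ‖u‖ ≤ M := by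
    refine ⟨max (max M₁ M₂) (max M₃ ‖u‖), ?_, ?_, ?_, ?_, ?_⟩
    · exact (norm_nonneg u).trans (by simp)
    · intro t ht; exact (hM₁ t ht).trans (by simp)
    · intro t ht; exact (hM₂ t ht).trans (by simp)
    · intro t ht; exact (hM₃ t ht).trans (by simp)
    · simp
  set K : ℝ := (2 * M + 1) * (M + 1) with hK
  have hKpos : 0 < K := by positivity
  set C : ℝ := (M + 1) * M + M * M + M * M * M + M * M * M * M + (2 * M + 1) * M * M with hC
  have hC0 : 0 ≤ C := by positivity
  set G : ℝ := C / K * (Real.exp K - 1) with hG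
  have hG0 : 0 ≤ G := by
    have : 1 ≤ Real.exp K := Real.one_le_exp hKpos.le
    have : 0 ≤ Real.exp K - 1 := by linarith
    positivity
  rw [Asymptotics.isLittleO_iff]
  intro c hc
  set ε : ℝ := min 1 (c / (G + 1)) with hε
  have hεpos : 0 < ε := lt_min one_pos (by positivity)
  have hε1 : ε ≤ 1 := min_le_left _ _
  obtain ⟨δ, hδ, H⟩ := lf_unif A hA x₀ u hεpos
  filter_upwards [ball_mem_nhds (0 : E) (lt_min hδ hεpos)] with h hh
  rw [mem_ball_zero_iff, lt_min_iff] at hh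
  have hhε := hh.2.le
  have hh1 : ‖h‖ ≤ 1 := hhε.trans hε1
  have H := H h hh.1
  -- the comparison curve
  set Z : ℝ → V := fun t => Y u t + t • A (x₀ + t • u) h (Y u t) with hZ
  have hZd : ∀ t ∈ Icc (0:ℝ) 1, HasDerivWithinAt Z
      (A (x₀ + t • u) u (Y u t) + (t • (fderiv ℝ A (x₀ + t • u) u h (Y u t)
        + A (x₀ + t • u) h (A (x₀ + t • u) u (Y u t))) + A (x₀ + t • u) h (Y u t)))
      (Icc 0 1) t := by
    intro t ht
    have h1 := hY u t ht
    have hl : HasDerivAt (fun t : ℝ => x₀ + t • u) u t := by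
      simpa using ((hasDerivAt_id t).smul_const u).const_add x₀
    have h2 : HasDerivAt (fun t : ℝ => A (x₀ + t • u)) (fderiv ℝ A (x₀ + t • u) u) t :=
      ((hA.differentiable (by simp) _).hasFDerivAt).comp_hasDerivAt t hl
    have h3 : HasDerivAt (fun t : ℝ => A (x₀ + t • u) h) (fderiv ℝ A (x₀ + t • u) u h) t := by
      simpa using h2.clm_apply (hasDerivAt_const t h)
    have h4 := (h3.hasDerivWithinAt (s := Icc 0 1)).clm_apply h1
    have h5 := (hasDerivWithinAt_id t (Icc (0:ℝ) 1)).smul h4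
    have h6 := h1.add h5
    refine (h6.congr_deriv ?_)
    simp
  have hbound := norm_le_gronwallBound_of_norm_deriv_right_le (f := fun t => Y (u + h) t - Z t)
    (f' := fun t => A (x₀ + t • (u + h)) (u + h) (Y (u + h) t)
      - (A (x₀ + t • u) u (Y u t) + (t • (fderiv ℝ A (x₀ + t • u) u h (Y u t)
        + A (x₀ + t • u) h (A (x₀ + t • u) u (Y u t))) + A (x₀ + t • u) h (Y u t))))
    (δ := 0) (K := K) (ε := C * ε * ‖h‖) (a := 0) (b := 1)
    (fun t ht => ((hY (u + h) t ht).sub (hZd t ht)).continuousWithinAt)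
    (fun t ht => lf_right ((hY (u + h) t (Ico_subset_Icc_self ht)).sub
      (hZd t (Ico_subset_Icc_self ht))) ht)
    (by simp [hZ, hY0]) (by
      intro t ht
      have ht := Ico_subset_Icc_self ht
      have H := H t ht
      have hMA := hMA t ht
      have hMD := hMD t ht
      have hMY := hMY t ht
      have hfl := flat (x₀ + t • u) u h (Y u t)
      simp only [hZ]
      generalize Y (u + h) t = y₁ at *
      generalize Y u t = y at *
      generalize A (x₀ + t • (u + h)) = A₁ at *
      generalize fderiv ℝ A (x₀ + t • u) = D at *
      generalize A (x₀ + t • u) = A₀ at *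
      obtain ⟨R, hR⟩ : ∃ R, R = A₁ - A₀ - t • D h := ⟨_, rfl⟩
      rw [← hR] at H
      have hA₁ : A₁ = R + A₀ + t • D h := by rw [hR]; abel
      have ht0 := ht.1
      have ht1 := ht.2
      have hnt : ‖t‖ ≤ 1 := by rw [Real.norm_eq_abs, abs_of_nonneg ht0]; exact ht1
      have hDh : ‖D h‖ ≤ M * ‖h‖ := (D.le_opNorm h).trans (by gcongr)
      have hA₁n : ‖A₁‖ ≤ 2 * M + 1 := by
        rw [hA₁]
        refine (norm_add₃_le).trans ?_
        rw [norm_smul]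
        have : ‖t‖ * ‖D h‖ ≤ 1 * (M * 1) := by
          gcongr
          exact hDh.trans (by gcongr)
        have : ‖R‖ ≤ 1 * 1 := H.trans (by gcongr)
        linarith
      have hu1 : ‖u + h‖ ≤ M + 1 := (norm_add_le _ _).trans (by gcongr)
      have n0 : ‖A₁ (u + h) (y₁ - (y + t • A₀ h y))‖ ≤ K * ‖y₁ - (y + t • A₀ h y)‖ :=
        (A₁.le_opNorm₂ _ _).trans (by rw [hK]; gcongr)
      have hAhy : ‖A₀ h y‖ ≤ M * ‖h‖ * M := (A₀.le_opNorm₂ _ _).trans (by gcongr)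
      have n1 : ‖R (u + h) y‖ ≤ (M + 1) * M * ε * ‖h‖ :=
        (R.le_opNorm₂ _ _).trans (by
          calc _ ≤ (ε * ‖h‖) * (M + 1) * M := by gcongr
            _ = _ := by ring)
      have n2 : ‖t • D h h y‖ ≤ M * M * ε * ‖h‖ := by
        rw [norm_smul]
        calc ‖t‖ * ‖D h h y‖ ≤ 1 * ((M * ‖h‖) * ε * M) := by
              gcongr
              exact ((D h).le_opNorm₂ _ _).trans (by gcongr)
          _ = _ := by ring
      have n3 : ‖t • R u (A₀ h y)‖ ≤ M * M * M * ε * ‖h‖ := by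
        rw [norm_smul]
        calc ‖t‖ * ‖R u (A₀ h y)‖ ≤ 1 * ((ε * ‖h‖) * M * (M * 1 * M)) := by
              gcongr
              exact (R.le_opNorm₂ _ _).trans (by gcongr; exact hAhy.trans (by gcongr))
          _ = _ := by ring
      have n4 : ‖(t * t) • D h u (A₀ h y)‖ ≤ M * M * M * M * ε * ‖h‖ := by
        rw [norm_smul, norm_mul]
        calc ‖t‖ * ‖t‖ * ‖D h u (A₀ h y)‖ ≤ 1 * 1 * ((M * ‖h‖) * M * (M * ε * M)) := by
              gcongr
              exact ((D h).le_opNorm₂ _ _).trans (by gcongr; exact hAhy.trans (by gcongr))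
          _ = _ := by ring
      have n5 : ‖t • A₁ h (A₀ h y)‖ ≤ (2 * M + 1) * M * M * ε * ‖h‖ := by
        rw [norm_smul]
        calc ‖t‖ * ‖A₁ h (A₀ h y)‖ ≤ 1 * ((2 * M + 1) * ‖h‖ * (M * ε * M)) := by
              gcongr
              exact (A₁.le_opNorm₂ _ _).trans (by gcongr; exact hAhy.trans (by gcongr))
          _ = _ := by ring
      have key : A₁ (u + h) y₁ - (A₀ u y + (t • (D u h y + A₀ h (A₀ u y)) + A₀ h y))
          = A₁ (u + h) (y₁ - (y + t • A₀ h y)) + (R (u + h) y + t • D h h y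
            + t • R u (A₀ h y) + (t * t) • D h u (A₀ h y) + t • A₁ h (A₀ h y)) := by
        rw [hfl, hR]
        simp only [map_add, map_sub, map_smul, ContinuousLinearMap.add_apply,
          ContinuousLinearMap.sub_apply, ContinuousLinearMap.smul_apply]
        module
      rw [key]
      refine (norm_add_le _ _).trans (add_le_add n0 ?_)
      refine (norm_add_le_of_le (norm_add_le_of_le (norm_add_le_of_le
        (norm_add_le_of_le n1 n2) n3) n4) n5).trans (le_of_eq ?_)
      rw [hC]; ring) 1 (by simp)
  rw [gronwallBound_of_K_ne_0 hKpos.ne'] at hbound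
  simp only [hZ, one_smul, zero_mul, zero_add, sub_zero, mul_one] at hbound
  have e1 : x₀ + u + h - x₀ = u + h := by abel
  have e2 : x₀ + u - x₀ = u := by abel
  rw [e1, e2, ContinuousLinearMap.flip_apply, sub_sub]
  refine hbound.trans ?_
  have : C * ε * ‖h‖ / K * (Real.exp K - 1) = (G * ε) * ‖h‖ := by rw [hG]; ring
  rw [this]
  gcongr
  calc G * ε ≤ (G + 1) * (c / (G + 1)) := by
        gcongr
        · linarith
        · exact min_le_right _ _
    _ = c := by field_simp

lemma lf_smooth (A : E → E →L[ℝ] V →L[ℝ] V) (hA : ContDiff ℝ (⊤ : ℕ∞) A) (y : E → V)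
    (hy : ∀ x, HasFDerivAt y ((A x).flip (y x)) x) : ContDiff ℝ (⊤ : ℕ∞) y := by
  have hd : Differentiable ℝ y := fun x => (hy x).differentiableAt
  rw [contDiff_infty]
  intro m
  induction m with
  | zero => exact_mod_cast contDiff_zero.2 hd.continuous
  | succ m ih =>
    push_cast
    rw [contDiff_succ_iff_fderiv]
    refine ⟨hd, by simp, ?_⟩
    have : fderiv ℝ y = fun x => (A x).flip (y x) := funext fun x => (hy x).fderiv
    rw [this]
    have hA' : ContDiff ℝ m A := hA.of_le (by exact_mod_cast le_top)
    exact ((ContinuousLinearMap.flipₗᵢ ℝ E V V).contDiff.comp hA').clm_apply ih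

lemma lf_unique (A : E → E →L[ℝ] V →L[ℝ] V) (hA : Continuous A) (x₀ : E) (y z : E → V)
    (hy : ∀ x, HasFDerivAt y ((A x).flip (y x)) x)
    (hz : ∀ x, HasFDerivAt z ((A x).flip (z x)) x) (h0 : y x₀ = z x₀) : y = z := by
  funext x
  obtain ⟨u, rfl⟩ : ∃ u, x = x₀ + u := ⟨x - x₀, by abel⟩
  have hcA : Continuous (fun t : ℝ => A (x₀ + t • u) u) :=
    (hA.comp (by fun_prop)).clm_apply continuous_const
  obtain ⟨M, hM⟩ := isCompact_Icc.exists_bound_of_continuousOn (s := Icc (0:ℝ) 1)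
    hcA.continuousOn
  have hder : ∀ t : ℝ, HasDerivAt (fun t : ℝ => y (x₀ + t • u) - z (x₀ + t • u))
      (A (x₀ + t • u) u (y (x₀ + t • u) - z (x₀ + t • u))) t := by
    intro t
    have hl : HasDerivAt (fun t : ℝ => x₀ + t • u) u t := by
      simpa using ((hasDerivAt_id t).smul_const u).const_add x₀
    have h1 := (hy (x₀ + t • u)).comp_hasDerivAt t hl
    have h2 := (hz (x₀ + t • u)).comp_hasDerivAt t hl
    have h3 := h1.sub h2
    simp only [ContinuousLinearMap.flip_apply, ← map_sub] at h3
    exact h3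
  have := eq_zero_of_abs_deriv_le_mul_abs_self_of_eq_zero_right (K := M) (a := 0) (b := 1)
    (fun t _ => (hder t).continuousAt.continuousWithinAt)
    (fun t _ => (hder t).hasDerivWithinAt) (by simp [h0])
    (fun t ht => (ContinuousLinearMap.le_opNorm _ _).trans (by
      gcongr; exact hM t (Ico_subset_Icc_self ht))) 1 (by simp)
  simpa [sub_eq_zero] using this

end core


section coords
variable {n p : ℕ}

/-- Elementary tensors used to assemble the coefficient operator. -/
noncomputable def lfL (i : Fin n) (j k : Fin p) :
    (Fin n → ℝ) →L[ℝ] (Fin p → ℝ) →L[ℝ] (Fin p → ℝ) :=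
  (ContinuousLinearMap.proj (R := ℝ) (φ := fun _ : Fin n => ℝ) i).smulRight
    ((ContinuousLinearMap.proj (R := ℝ) (φ := fun _ : Fin p => ℝ) k).smulRight
      (Pi.single j (1 : ℝ) : Fin p → ℝ))

/-- The coefficient operator `A(x) v y`. -/
noncomputable def lfA (c : Fin p → Fin p → Fin n → ℝ) :
    (Fin n → ℝ) →L[ℝ] (Fin p → ℝ) →L[ℝ] (Fin p → ℝ) :=
  ∑ i, ∑ j, ∑ k, c k j i • lfL i j k

lemma lfA_single (c : Fin p → Fin p → Fin n → ℝ) (i : Fin n) (y : Fin p → ℝ) (j : Fin p) :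
    lfA c (Pi.single i 1) y j = ∑ k, c k j i * y k := by
  simp only [lfA, lfL, ContinuousLinearMap.sum_apply, Finset.sum_apply,
    ContinuousLinearMap.smul_apply, ContinuousLinearMap.smulRight_apply,
    ContinuousLinearMap.proj_apply, Pi.smul_apply, smul_eq_mul]
  rw [Finset.sum_eq_single i]
  · rw [Finset.sum_eq_single j]
    · simp
    · intro b _ hb
      simp [Pi.single_apply, hb.symm]
    · simp
  · intro b _ hb
    simp [Pi.single_apply, hb]
  · simp

lemma lfA_smooth (F : Fin p → Fin p → Fin n → (Fin n → ℝ) → ℝ)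
    (hF : ∀ (a j : Fin p) (i : Fin n), ContDiff ℝ (⊤ : ℕ∞) (F a j i)) :
    ContDiff ℝ (⊤ : ℕ∞) (fun x => lfA fun k j i => F k j i x) := by
  unfold lfA
  exact ContDiff.sum fun i _ => ContDiff.sum fun j _ => ContDiff.sum fun k _ =>
    (hF k j i).smul contDiff_const

lemma lfA_fderiv (F : Fin p → Fin p → Fin n → (Fin n → ℝ) → ℝ)
    (hF : ∀ (a j : Fin p) (i : Fin n), ContDiff ℝ (⊤ : ℕ∞) (F a j i)) (x v : Fin n → ℝ) :
    fderiv ℝ (fun x => lfA fun k j i => F k j i x) x v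
      = lfA fun k j i => fderiv ℝ (F k j i) x v := by
  have h : HasFDerivAt (fun x => lfA fun k j i => F k j i x)
      (∑ i, ∑ j, ∑ k, (fderiv ℝ (F k j i) x).smulRight (lfL i j k)) x := by
    unfold lfA
    exact HasFDerivAt.fun_sum fun i _ => HasFDerivAt.fun_sum fun j _ =>
      HasFDerivAt.fun_sum fun k _ =>
        ((hF k j i).differentiable (by simp) x).hasFDerivAt.smul_const _
  rw [h.fderiv]
  simp [lfA, ContinuousLinearMap.sum_apply]

lemma lfA_flat (F : Fin p → Fin p → Fin n → (Fin n → ℝ) → ℝ)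
    (hF : ∀ (a j : Fin p) (i : Fin n), ContDiff ℝ (⊤ : ℕ∞) (F a j i))
    (hint : ∀ (x : Fin n → ℝ) (a j : Fin p) (i k : Fin n),
      pd k (F a j i) x - pd i (F a j k) x
        + ∑ r, (F a r k x * F r j i x - F a r i x * F r j k x) = 0)
    (x v w : Fin n → ℝ) (y : Fin p → ℝ) :
    fderiv ℝ (fun x => lfA fun k j i => F k j i x) x v w y
        + lfA (fun k j i => F k j i x) w (lfA (fun k j i => F k j i x) v y)
      = fderiv ℝ (fun x => lfA fun k j i => F k j i x) x w v y
        + lfA (fun k j i => F k j i x) v (lfA (fun k j i => F k j i x) w y) := by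
  have hb : ∀ m i : Fin n,
      fderiv ℝ (fun x => lfA fun k j i => F k j i x) x (Pi.single m 1) (Pi.single i 1) y
        + lfA (fun k j i => F k j i x) (Pi.single i 1)
          (lfA (fun k j i => F k j i x) (Pi.single m 1) y)
      = fderiv ℝ (fun x => lfA fun k j i => F k j i x) x (Pi.single i 1) (Pi.single m 1) y
        + lfA (fun k j i => F k j i x) (Pi.single m 1)
          (lfA (fun k j i => F k j i x) (Pi.single i 1) y) := by
    intro m i
    funext j
    rw [Pi.add_apply, Pi.add_apply, lfA_fderiv F hF, lfA_fderiv F hF]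
    simp only [lfA_single]
    have h1 : ∀ i m : Fin n, ∑ k, F k j i x * ∑ r, F r k m x * y r
        = ∑ a, (∑ r, F a r m x * F r j i x) * y a := by
      intro i m
      simp only [Finset.mul_sum, Finset.sum_mul]
      rw [Finset.sum_comm]
      exact Finset.sum_congr rfl fun _ _ => Finset.sum_congr rfl fun _ _ => by ring
    rw [h1, h1, ← Finset.sum_add_distrib, ← Finset.sum_add_distrib]
    refine Finset.sum_congr rfl fun a _ => ?_
    have := hint x a j i m
    rw [Finset.sum_sub_distrib] at this
    simp only [pd] at this
    linear_combination y a * this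
  generalize fderiv ℝ (fun x => lfA fun k j i => F k j i x) x = D at *
  generalize lfA (fun k j i => F k j i x) = A at *
  have ext : ∀ v, (∀ i, D v (Pi.single i 1) y + A (Pi.single i 1) (A v y)
      = D (Pi.single i 1) v y + A v (A (Pi.single i 1) y)) →
      ∀ w, D v w y + A w (A v y) = D w v y + A v (A w y) := by
    intro v h w
    have : (D v).flip y + A.flip (A v y) = (D.flip v).flip y + (A v).comp (A.flip y) := by
      refine ContinuousLinearMap.coe_injective (LinearMap.pi_ext' fun i => LinearMap.ext_ring ?_)
      exact h i
    exact congrArg (fun L => L w) this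
  exact ext v (fun i => (ext (Pi.single i 1) (fun m => hb i m) v).symm) w

end coords

end helpers

/-- linear Frobenius theorem: if the smooth coefficients `F^k_{ji}`
satisfy the integrability condition
`∂_k F^a_{ji} − ∂_i F^a_{jk} + Σ_r (F^a_{rk} F^r_{ji} − F^a_{ri} F^r_{jk}) = 0`
everywhere, then for every initial condition `y(x₀) = y₀` there is exactly one smooth
solution of `∂y_j/∂x^i = Σ_k F^k_{ji} y_k`. -/
theorem linear_frobenius (n p : ℕ)
    (F : Fin p → Fin p → Fin n → (Fin n → ℝ) → ℝ)
    (hF : ∀ (a j : Fin p) (i : Fin n), ContDiff ℝ (⊤ : ℕ∞) (F a j i))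
    (hint : ∀ (x : Fin n → ℝ) (a j : Fin p) (i k : Fin n),
      pd k (F a j i) x - pd i (F a j k) x
        + ∑ r, (F a r k x * F r j i x - F a r i x * F r j k x) = 0)
    (x₀ : Fin n → ℝ) (y₀ : Fin p → ℝ) :
    ∃! y : (Fin n → ℝ) → (Fin p → ℝ),
      ContDiff ℝ (⊤ : ℕ∞) y ∧
      (∀ (x : Fin n → ℝ) (i : Fin n) (j : Fin p),
        pd i (fun z => y z j) x = ∑ k, F k j i x * y x k) ∧
      y x₀ = y₀ := by
  obtain ⟨A, hAdef⟩ : ∃ A : (Fin n → ℝ) → (Fin n → ℝ) →L[ℝ] (Fin p → ℝ) →L[ℝ] (Fin p → ℝ),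
    A = fun x => lfA fun k j i => F k j i x := ⟨_, rfl⟩
  have hA : ContDiff ℝ (⊤ : ℕ∞) A := hAdef ▸ lfA_smooth F hF
  have flat : ∀ x v w y, fderiv ℝ A x v w y + A x w (A x v y)
      = fderiv ℝ A x w v y + A x v (A x w y) := by
    rw [hAdef]; exact lfA_flat F hF hint
  have hpd : ∀ (y : (Fin n → ℝ) → (Fin p → ℝ)) (x : Fin n → ℝ) (i : Fin n) (j : Fin p),
      DifferentiableAt ℝ y x →
      pd i (fun z => y z j) x = fderiv ℝ y x (Pi.single i 1) j := by
    intro y x i j hd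
    rw [pd, (hasFDerivAt_pi'.1 hd.hasFDerivAt j).fderiv]
    rfl
  have hAs : ∀ x i (y : Fin p → ℝ) j, A x (Pi.single i 1) y j = ∑ k, F k j i x * y k := by
    intro x i y j
    rw [hAdef]; exact lfA_single _ _ _ _
  have hex : ∀ u : Fin n → ℝ, ∃ α : ℝ → (Fin p → ℝ), α 0 = y₀ ∧
      ∀ t ∈ Set.Icc (0:ℝ) 1,
        HasDerivWithinAt α (A (x₀ + t • u) u (α t)) (Set.Icc 0 1) t := fun u =>
    lf_ode (fun t => A (x₀ + t • u) u)
      ((hA.continuous.comp (by fun_prop)).clm_apply continuous_const) y₀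
  choose Y hY0 hY using hex
  have hsol := lf_core A (hA.of_le (by exact_mod_cast le_top)) flat x₀ y₀ Y hY0 hY
  have hval : Y (x₀ - x₀) 1 = y₀ := by
    have h := hY 0
    simp only [map_zero, ContinuousLinearMap.zero_apply] at h
    have := constant_of_derivWithin_zero
      (fun t ht => (h t ht).differentiableWithinAt)
      (fun t ht => (h t (Set.Ico_subset_Icc_self ht)).derivWithin
        (uniqueDiffOn_Icc one_pos t (Set.Ico_subset_Icc_self ht))) 1 (by simp)
    rw [sub_self, this, hY0]
  refine ⟨fun x => Y (x - x₀) 1, ⟨lf_smooth A hA _ hsol, ?_, hval⟩, ?_⟩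
  · intro x i j
    rw [hpd _ x i j (hsol x).differentiableAt, (hsol x).fderiv]
    exact hAs _ _ _ _
  · rintro z ⟨hz, hzd, hz0⟩
    refine lf_unique A hA.continuous x₀ z _ (fun x => ?_) hsol (hz0.trans hval.symm)
    have hd : DifferentiableAt ℝ z x := hz.differentiable (by simp) x
    have : (A x).flip (z x) = fderiv ℝ z x := by
      refine ContinuousLinearMap.coe_injective (LinearMap.pi_ext' fun i => LinearMap.ext_ring ?_)
      funext j
      have := hzd x i j
      rw [hpd z x i j hd, ← hAs] at this
      exact this.symm
    rw [this]
    exact hd.hasFDerivAt
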